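/- Let Δ, n ≥ 1 be natural numbers, let α be a string, and let P be a set of strings such that there is no leaf bag which is n-bushy from α for P. If V is a leaf bag which is (n+Δ−1)-bushy from α, then there exists a subset T of V such that T is a leaf bag which is Δ-bushy from α, and for each β ∈ T there is no leaf bag which is n-bushy from β for P. -/

import Mathlib

/-- A leaf bag: a finite nonempty set of pairwise incomparable strings
(no element is a prefix of another). -/
def IsLeafBag (T : Finset (List ℕ)) : Prop :=
  T.Nonempty ∧ ∀ σ ∈ T, ∀ τ ∈ T, σ ≠ τ → ¬ σ <+: τ

/-- `T` is an `n`-bushy leaf bag from the string `α`. -/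
def BushyFrom (n : ℕ) (α : List ℕ) (T : Finset (List ℕ)) : Prop :=
  IsLeafBag T ∧ (∀ τ ∈ T, α <+: τ) ∧
  ∀ τ : List ℕ, α <+: τ → (∃ ρ ∈ T, τ <+: ρ ∧ τ ≠ ρ) →
    ∃ S : Finset ℕ, n ≤ S.card ∧ ∀ k ∈ S, ∃ ρ ∈ T, (τ ++ [k]) <+: ρ

/-- `T` is `n`-bushy from `α` for the set of strings `P`. -/
def BushyFromFor (n : ℕ) (α : List ℕ) (P : Set (List ℕ)) (T : Finset (List ℕ)) : Prop :=
  BushyFrom n α T ∧ ↑T ⊆ P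

theorem append_singleton_inj_of_prefix {σ ρ : List ℕ} {j k : ℕ}
    (hj : σ ++ [j] <+: ρ) (hk : σ ++ [k] <+: ρ) : j = k := by
  have h := (List.prefix_of_prefix_length_le hj hk (by simp)).eq_of_length (by simp)
  simpa using h

theorem append_singleton_prefix_of_prefix {σ τ ρ : List ℕ} {k : ℕ}
    (hσ : σ <+: τ) (hne : σ ≠ τ) (hk : σ ++ [k] <+: ρ) (hτ : τ <+: ρ) : σ ++ [k] <+: τ := by
  refine List.prefix_of_prefix_length_le hk hτ ?_
  have h₁ := hσ.length_le
  have h₂ : σ.length ≠ τ.length := fun h => hne (hσ.eq_of_length h)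
  simp only [List.length_append, List.length_singleton]
  omega

theorem BushyFrom.singleton (n : ℕ) (σ : List ℕ) : BushyFrom n σ {σ} := by
  refine ⟨⟨by simp, by simp⟩, by simp, ?_⟩
  rintro τ hτ ⟨ρ, hρ, hp, hne⟩
  rw [Finset.mem_singleton] at hρ
  subst hρ
  exact absurd (hp.eq_of_length (le_antisymm hp.length_le hτ.length_le)) hne

theorem BushyFrom.biUnion {n : ℕ} (hn : 1 ≤ n) {σ : List ℕ} {S : Finset ℕ} (hS : n ≤ S.card)
    {U : ℕ → Finset (List ℕ)} (hU : ∀ k ∈ S, BushyFrom n (σ ++ [k]) (U k)) :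
    BushyFrom n σ (S.biUnion U) := by
  refine ⟨⟨?_, ?_⟩, ?_, ?_⟩
  · obtain ⟨k, hk⟩ := Finset.card_pos.mp (hn.trans hS)
    obtain ⟨ρ, hρ⟩ := (hU k hk).1.1
    exact ⟨ρ, Finset.mem_biUnion.mpr ⟨k, hk, hρ⟩⟩
  · intro ρ hρ τ hτ hne hp
    obtain ⟨j, hj, hρj⟩ := Finset.mem_biUnion.mp hρ
    obtain ⟨k, hk, hτk⟩ := Finset.mem_biUnion.mp hτ
    obtain rfl := append_singleton_inj_of_prefix (((hU j hj).2.1 ρ hρj).trans hp)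
      ((hU k hk).2.1 τ hτk)
    exact (hU j hj).1.2 ρ hρj τ hτk hne hp
  · intro τ hτ
    obtain ⟨k, hk, hτk⟩ := Finset.mem_biUnion.mp hτ
    exact (List.prefix_append σ [k]).trans ((hU k hk).2.1 τ hτk)
  · rintro τ hτ ⟨ρ, hρ, hp, hne⟩
    by_cases hστ : σ = τ
    · subst hστ
      refine ⟨S, hS, fun k hk => ?_⟩
      obtain ⟨ξ, hξ⟩ := (hU k hk).1.1
      exact ⟨ξ, Finset.mem_biUnion.mpr ⟨k, hk, hξ⟩, (hU k hk).2.1 ξ hξ⟩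
    · obtain ⟨k, hk, hρk⟩ := Finset.mem_biUnion.mp hρ
      obtain ⟨R, hR, hR'⟩ := (hU k hk).2.2 τ
        (append_singleton_prefix_of_prefix hτ hστ ((hU k hk).2.1 ρ hρk) hp) ⟨ρ, hρk, hp, hne⟩
      refine ⟨R, hR, fun i hi => ?_⟩
      obtain ⟨ξ, hξ, hξp⟩ := hR' i hi
      exact ⟨ξ, Finset.mem_biUnion.mpr ⟨k, hk, hξ⟩, hξp⟩

theorem BushyFrom.filter_prefix {n : ℕ} {σ β : List ℕ} {V : Finset (List ℕ)}
    (hV : BushyFrom n σ V) (hσ : σ <+: β) (hβ : ∃ ρ ∈ V, β <+: ρ) :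
    BushyFrom n β (V.filter (β <+: ·)) := by
  refine ⟨⟨?_, ?_⟩, fun τ hτ => (Finset.mem_filter.mp hτ).2, ?_⟩
  · obtain ⟨ρ, hρ, hp⟩ := hβ
    exact ⟨ρ, Finset.mem_filter.mpr ⟨hρ, hp⟩⟩
  · exact fun ρ hρ τ hτ => hV.1.2 ρ (Finset.mem_filter.mp hρ).1 τ (Finset.mem_filter.mp hτ).1
  · rintro τ hτ ⟨ρ, hρ, hp, hne⟩
    obtain ⟨S, hS, hS'⟩ := hV.2.2 τ (hσ.trans hτ) ⟨ρ, (Finset.mem_filter.mp hρ).1, hp, hne⟩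
    refine ⟨S, hS, fun k hk => ?_⟩
    obtain ⟨ξ, hξ, hξp⟩ := hS' k hk
    exact ⟨ξ, Finset.mem_filter.mpr ⟨hξ, hτ.trans ((List.prefix_append τ [k]).trans hξp)⟩, hξp⟩

theorem BushyFromFor.biUnion {n : ℕ} (hn : 1 ≤ n) {σ : List ℕ} {P : Set (List ℕ)} {S : Finset ℕ}
    (hS : n ≤ S.card) (hU : ∀ k ∈ S, ∃ U, BushyFromFor n (σ ++ [k]) P U) :
    ∃ U, BushyFromFor n σ P U := by
  have : ∀ k, ∃ U, k ∈ S → BushyFromFor n (σ ++ [k]) P U := fun k => by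
    by_cases hk : k ∈ S
    · obtain ⟨U, h⟩ := hU k hk
      exact ⟨U, fun _ => h⟩
    · exact ⟨∅, fun h => absurd h hk⟩
  choose U hU using this
  refine ⟨S.biUnion U, BushyFrom.biUnion hn hS fun k hk => (hU k hk).1, fun τ hτ => ?_⟩
  obtain ⟨k, hk, hτk⟩ := Finset.mem_biUnion.mp (Finset.mem_coe.mp hτ)
  exact (hU k hk).2 hτk

/-- The dichotomy behind the theorem, by induction on the height of `V` above `σ`. -/
theorem BushyFrom.exists_bushyFromFor_or {Δ n : ℕ} (hΔ : 1 ≤ Δ) (hn : 1 ≤ n)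
    (P : Set (List ℕ)) (m : ℕ) (σ : List ℕ) (V : Finset (List ℕ))
    (hm : ∀ τ ∈ V, τ.length ≤ σ.length + m) (hV : BushyFrom (n + Δ - 1) σ V) :
    (∃ U, BushyFromFor n σ P U) ∨
      ∃ T, BushyFromFor Δ σ {β | β ∈ V ∧ ¬ ∃ U, BushyFromFor n β P U} T := by
  classical
  induction m generalizing σ V with
  | zero =>
    by_cases hσ : ∃ U, BushyFromFor n σ P U
    · exact .inl hσ
    · obtain ⟨ρ, hρ⟩ := hV.1.1
      obtain rfl := (hV.2.1 ρ hρ).eq_of_length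
        (le_antisymm (hV.2.1 ρ hρ).length_le (hm ρ hρ))
      exact .inr ⟨{σ}, BushyFrom.singleton Δ σ, by simpa using ⟨hρ, by simpa using hσ⟩⟩
  | succ m ih =>
    refine or_iff_not_imp_left.mpr fun hσ => ?_
    by_cases hσV : σ ∈ V
    · exact ⟨{σ}, BushyFrom.singleton Δ σ, by simpa using ⟨hσV, by simpa using hσ⟩⟩
    obtain ⟨ρ, hρ⟩ := hV.1.1
    obtain ⟨S, hS, hS'⟩ := hV.2.2 σ List.prefix_rfl
      ⟨ρ, hρ, hV.2.1 ρ hρ, fun h => hσV (h ▸ hρ)⟩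
    have hlt : (S.filter fun k => ∃ U, BushyFromFor n (σ ++ [k]) P U).card < n := by
      by_contra! h
      exact hσ (BushyFromFor.biUnion hn h fun k hk => (Finset.mem_filter.mp hk).2)
    have hcard := Finset.card_filter_add_card_filter_not (s := S)
      (fun k => ∃ U, BushyFromFor n (σ ++ [k]) P U)
    refine BushyFromFor.biUnion hΔ
      (S := S.filter fun k => ¬ ∃ U, BushyFromFor n (σ ++ [k]) P U) (by omega) fun k hk => ?_
    obtain ⟨hkS, hk⟩ := Finset.mem_filter.mp hk
    obtain ⟨T, hT, hTP⟩ := (ih (σ ++ [k]) (V.filter (σ ++ [k] <+: ·)) (fun τ hτ => by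
        have := hm τ (Finset.mem_filter.mp hτ).1
        simp only [List.length_append, List.length_singleton]
        omega)
      (hV.filter_prefix (List.prefix_append σ [k]) (hS' k hkS))).resolve_left hk
    exact ⟨T, hT, fun β hβ => ⟨(Finset.mem_filter.mp (hTP hβ).1).1, (hTP hβ).2⟩⟩

/-- Lemma 4: Suppose there is no `n`-bushy leaf bag from `α` for `P`. If `V` is an
`(n+Δ-1)`-bushy leaf bag from `α`, then `V` has a subset `T` which is a `Δ`-bushy
leaf bag from `α` such that for each `β ∈ T` there is no `n`-bushy leaf bag
from `β` for `P`. -/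
theorem bushy_no_bushy_subset (Δ n : ℕ) (hΔ : 1 ≤ Δ) (hn : 1 ≤ n) (α : List ℕ)
    (P : Set (List ℕ))
    (hno : ¬ ∃ T : Finset (List ℕ), BushyFromFor n α P T)
    (V : Finset (List ℕ)) (hV : BushyFrom (n + Δ - 1) α V) :
    ∃ T ⊆ V, BushyFrom Δ α T ∧
      ∀ β ∈ T, ¬ ∃ U : Finset (List ℕ), BushyFromFor n β P U := by
  obtain ⟨T, hT, hTV⟩ := (hV.exists_bushyFromFor_or hΔ hn P (V.sup List.length) α V
    fun τ hτ => (Finset.le_sup (f := List.length) hτ).trans (Nat.le_add_left _ _)).resolve_left hno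
  exact ⟨T, fun β hβ => (hTV hβ).1, hT, fun β hβ => (hTV hβ).2⟩
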